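/- In the theory T_OG, fix a ∈ O and b ∈ G such that E(a,b,0) and ¬E(a,b,1). Then a ⫝d_∅ b, but a ⫝̸d_{acl(∅)} b. In particular, in T_OG dividing independence over a base C does not imply dividing independence over acl(C). -/

import Mathlib

open FirstOrder FirstOrder.Language Set Cardinal

universe u v w x

namespace PaperDiv

variable (L : FirstOrder.Language.{u, v}) (M : Type w) [L.Structure M]

/-- Two (possibly infinite) tuples have the same complete type over the parameter set `C`. -/
def SameType (C : Set M) {ι : Type x} (a b : ι → M) : Prop :=
  ∀ (n : ℕ) (φ : L.Formula (ι ⊕ Fin n)) (c : Fin n → M),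
    (∀ i, c i ∈ C) → (φ.Realize (Sum.elim a c) ↔ φ.Realize (Sum.elim b c))

/-- The model-theoretic algebraic closure of a set `C`. -/
def acl (C : Set M) : Set M :=
  {a | ∃ (n : ℕ) (φ : L.Formula (Fin (n + 1))) (c : Fin n → M),
    (∀ i, c i ∈ C) ∧ φ.Realize (Fin.cons a c) ∧ {x : M | φ.Realize (Fin.cons x c)}.Finite}

/-- A sequence of `ι`-tuples is indiscernible over `C`. -/
def Indiscernible (C : Set M) {ι : Type x} (b : ℕ → ι → M) : Prop :=
  ∀ (n : ℕ) (s t : Fin n → ℕ), StrictMono s → StrictMono t →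
    SameType L M C (fun p : Fin n × ι => b (s p.1) p.2) (fun p : Fin n × ι => b (t p.1) p.2)

/-- The formula `φ(x, b)` divides over `C`:  there is a `C`-indiscernible sequence starting
with `b` along which the instances of `φ` are `k`-inconsistent. -/
def FormulaDividesOver (C : Set M) {ι : Type x} {m : ℕ}
    (φ : L.Formula (ι ⊕ Fin m)) (b : Fin m → M) : Prop :=
  ∃ (bs : ℕ → Fin m → M) (k : ℕ), 0 < k ∧ bs 0 = b ∧ Indiscernible L M C bs ∧
    ∀ s : Finset ℕ, s.card = k → ¬∃ x : ι → M, ∀ i ∈ s, φ.Realize (Sum.elim x (bs i))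

/-- The complete type of the tuple `a` over the parameter set `B` divides over `C`. -/
def TypeDividesOver (C B : Set M) {ι : Type x} (a : ι → M) : Prop :=
  ∃ (m : ℕ) (φ : L.Formula (ι ⊕ Fin m)) (b : Fin m → M),
    (∀ i, b i ∈ B) ∧ φ.Realize (Sum.elim a b) ∧ FormulaDividesOver L M C φ b

/-- The complete type of the tuple `a` over the parameter set `B` forks over `C`: it implies a
finite disjunction of formulas (with arbitrary parameters), each of which divides over `C`. -/
def TypeForksOver (C B : Set M) {ι : Type x} (a : ι → M) : Prop :=
  ∃ (N : ℕ) (m : Fin N → ℕ) (φ : ∀ j, L.Formula (ι ⊕ Fin (m j))) (b : ∀ j, Fin (m j) → M),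
    (∀ j, FormulaDividesOver L M C (φ j) (b j)) ∧
    ∀ x : ι → M, SameType L M B x a → ∃ j, (φ j).Realize (Sum.elim x (b j))

/-- Dividing independence: `A ⫝d_C B`, i.e. `tp(A/BC)` does not divide over `C`. -/
def dind (A C B : Set M) : Prop :=
  ¬TypeDividesOver L M C (B ∪ C) (fun x : A => (x : M))

/-- Forking independence: `A ⫝f_C B`, i.e. `tp(A/BC)` does not fork over `C`. -/
def find (A C B : Set M) : Prop :=
  ¬TypeForksOver L M C (B ∪ C) (fun x : A => (x : M))

/-- Algebraic independence: `A ⫝a_C B`. -/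
def aind (A C B : Set M) : Prop :=
  acl L M (A ∪ C) ∩ acl L M (B ∪ C) = acl L M C

/-- M-independence: `A ⫝M_C B`. -/
def Mind (A C B : Set M) : Prop :=
  ∀ D : Set M, C ⊆ D → D ⊆ acl L M (B ∪ C) → aind L M A D B

/-- m-independence: `A ⫝m_C B`. -/
def mind (A C B : Set M) : Prop :=
  ∀ D : Set M, C ⊆ D → D ⊆ B ∪ C → aind L M A D B

/-- `M` is a monster model (with respect to the cardinal `κ` bounding the "small" sets):
it is strongly `κ`-homogeneous and `κ`-saturated. -/
structure IsMonster (κ : Cardinal.{w}) : Prop where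
  aleph0_lt : ℵ₀ < κ
  homogeneous : ∀ (C : Set M) {ι : Type w} (a b : ι → M), #C < κ → #ι < κ →
    SameType L M C a b → ∃ σ : M ≃[L] M, (∀ c ∈ C, σ c = c) ∧ ∀ i, σ (a i) = b i
  saturated : ∀ (C : Set M) {ι : Type w}, #C < κ → #ι < κ →
    ∀ p : Set ((n : ℕ) × L.Formula (ι ⊕ Fin n) × (Fin n → M)),
      (∀ q ∈ p, ∀ i, q.2.2 i ∈ C) →
      (∀ s : Finset ((n : ℕ) × L.Formula (ι ⊕ Fin n) × (Fin n → M)), ↑s ⊆ p →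
        ∃ x : ι → M, ∀ q ∈ s, q.2.1.Realize (Sum.elim x q.2.2)) →
      ∃ x : ι → M, ∀ q ∈ p, q.2.1.Realize (Sum.elim x q.2.2)


/-! ### The theory `T_OG` -/

/-- The relation symbols of the language `𝓛`: unary sort predicates `O`, `G`, `C`, a relation
`R` of type `G × G × C`, and a relation `E` of type `O × G × C`. -/
inductive RelOG : ℕ → Type
  | O : RelOG 1
  | G : RelOG 1
  | C : RelOG 1
  | R : RelOG 3
  | E : RelOG 3

/-- The constant symbols `0` and `1` (of sort `C`) of the language `𝓛'`. -/
inductive FnOG : ℕ → Type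
  | zero : FnOG 0
  | one : FnOG 0

/-- The language `𝓛'` (with the constants `0`, `1`). -/
abbrev LOG' : FirstOrder.Language := ⟨FnOG, RelOG⟩

/-- The language `𝓛 = 𝓛' ∖ {0, 1}`. -/
abbrev LOG : FirstOrder.Language := ⟨fun _ => Empty, RelOG⟩

/-- The inclusion of languages `𝓛 → 𝓛'`. -/
def redOG : LOG →ᴸ LOG' := ⟨fun {_} e => Empty.elim e, fun {_} r => r⟩

instance : Countable ((l : ℕ) × LOG'.Functions l) :=
  ⟨⟨fun x => match x with | ⟨_, FnOG.zero⟩ => 0 | ⟨_, FnOG.one⟩ => 1, by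
    rintro ⟨l₁, f₁⟩ ⟨l₂, f₂⟩ h
    cases f₁ <;> cases f₂
    · rfl
    · exact (Nat.zero_ne_one h).elim
    · exact (Nat.one_ne_zero h).elim
    · rfl⟩⟩

section
variable {S : Type*}

/-- The interpretation of the constant `0` in an `𝓛'`-structure. -/
def ogZero [LOG'.Structure S] : S := Structure.funMap (L := LOG') FnOG.zero ![]

/-- The interpretation of the constant `1` in an `𝓛'`-structure. -/
def ogOne [LOG'.Structure S] : S := Structure.funMap (L := LOG') FnOG.one ![]

/-- Sort `O` in an `𝓛'`-structure. -/
def sortO' [LOG'.Structure S] (x : S) : Prop := Structure.RelMap (L := LOG') RelOG.O ![x]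
/-- Sort `G` in an `𝓛'`-structure. -/
def sortG' [LOG'.Structure S] (x : S) : Prop := Structure.RelMap (L := LOG') RelOG.G ![x]
/-- Sort `C` in an `𝓛'`-structure. -/
def sortC' [LOG'.Structure S] (x : S) : Prop := Structure.RelMap (L := LOG') RelOG.C ![x]
/-- The relation `R` in an `𝓛'`-structure. -/
def relR' [LOG'.Structure S] (v w c : S) : Prop := Structure.RelMap (L := LOG') RelOG.R ![v, w, c]
/-- The relation `E` in an `𝓛'`-structure. -/
def relE' [LOG'.Structure S] (o v c : S) : Prop := Structure.RelMap (L := LOG') RelOG.E ![o, v, c]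

/-- Sort `O` in an `𝓛`-structure. -/
def sortO [LOG.Structure S] (x : S) : Prop := Structure.RelMap (L := LOG) RelOG.O ![x]
/-- Sort `G` in an `𝓛`-structure. -/
def sortG [LOG.Structure S] (x : S) : Prop := Structure.RelMap (L := LOG) RelOG.G ![x]
/-- Sort `C` in an `𝓛`-structure. -/
def sortC [LOG.Structure S] (x : S) : Prop := Structure.RelMap (L := LOG) RelOG.C ![x]
/-- The relation `R` in an `𝓛`-structure. -/
def relR [LOG.Structure S] (v w c : S) : Prop := Structure.RelMap (L := LOG) RelOG.R ![v, w, c]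
/-- The relation `E` in an `𝓛`-structure. -/
def relE [LOG.Structure S] (o v c : S) : Prop := Structure.RelMap (L := LOG) RelOG.E ![o, v, c]

/-- The defining conditions of the class `𝒦` (apart from finiteness): a three-sorted
structure (encoded with sort predicates) in which `0 ≠ 1` are the only elements of sort `C`,
`R(x,y,0)` and `R(x,y,1)` are disjoint graph relations on `G`, and whenever `R(v,w,c)` holds
there is no `o` of sort `O` with `E(o,v,c)` and `E(o,w,c)`. -/
def OGAxioms (S : Type*) [LOG'.Structure S] : Prop :=
  (∀ x : S, sortO' x ∨ sortG' x ∨ sortC' x) ∧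
  (∀ x : S, ¬(sortO' x ∧ sortG' x) ∧ ¬(sortO' x ∧ sortC' x) ∧ ¬(sortG' x ∧ sortC' x)) ∧
  (∀ v w c : S, relR' v w c → sortG' v ∧ sortG' w ∧ sortC' c) ∧
  (∀ o v c : S, relE' o v c → sortO' o ∧ sortG' v ∧ sortC' c) ∧
  (ogZero : S) ≠ ogOne ∧ sortC' (ogZero : S) ∧ sortC' (ogOne : S) ∧
  (∀ c : S, sortC' c → c = ogZero ∨ c = ogOne) ∧
  (∀ v w c : S, relR' v w c → relR' w v c) ∧
  (∀ v c : S, ¬relR' v v c) ∧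
  (∀ v w : S, ¬(relR' v w (ogZero : S) ∧ relR' v w (ogOne : S))) ∧
  (∀ v w c : S, relR' v w c → ¬∃ o : S, relE' o v c ∧ relE' o w c)

end

/-- The Fraïssé class `𝒦` of finite `𝓛'`-structures. -/
def KOG : Set (CategoryTheory.Bundled.{w} LOG'.Structure) :=
  {S | Finite S.α ∧ @OGAxioms S.α S.str}

/-- The theory `T_OG`: the complete theory of the reduct to `𝓛` of the Fraïssé limit of `𝒦`. -/
def TOG (M' : Type w) [LOG'.Structure M'] : LOG.Theory :=
  @FirstOrder.Language.completeTheory LOG M' (redOG.reduct M')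

/-- The theory of `M` has the `n`-strong order property `SOP_n` (for `n ≥ 1`): some formula
`φ(x̄, ȳ)` admits an infinite chain but no cycle of length `n`. -/
def HasSOP (L : FirstOrder.Language.{u, v}) (M : Type w) [L.Structure M] (n : ℕ) [NeZero n] :
    Prop :=
  ∃ (k : ℕ) (φ : L.Formula (Fin k ⊕ Fin k)),
    (∃ a : ℕ → Fin k → M, ∀ i j : ℕ, i < j → φ.Realize (Sum.elim (a i) (a j))) ∧
    ¬∃ c : Fin n → Fin k → M, ∀ i : Fin n, φ.Realize (Sum.elim (c i) (c (i + 1)))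

section AtomicTypes

variable {ι κ S T U : Type*} [LOG.Structure S] [LOG.Structure T] [LOG.Structure U]

/-! A relation symbol holds of a tuple iff the corresponding predicate holds of its entries. -/

theorem relMap_O_iff (xs : Fin 1 → S) :
    Structure.RelMap (L := LOG) RelOG.O xs ↔ sortO (xs 0) := by
  rw [sortO, iff_eq_eq]
  congr 1
  ext i
  fin_cases i
  rfl

theorem relMap_G_iff (xs : Fin 1 → S) :
    Structure.RelMap (L := LOG) RelOG.G xs ↔ sortG (xs 0) := by
  rw [sortG, iff_eq_eq]
  congr 1
  ext i
  fin_cases i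
  rfl

theorem relMap_C_iff (xs : Fin 1 → S) :
    Structure.RelMap (L := LOG) RelOG.C xs ↔ sortC (xs 0) := by
  rw [sortC, iff_eq_eq]
  congr 1
  ext i
  fin_cases i
  rfl

theorem relMap_R_iff (xs : Fin 3 → S) :
    Structure.RelMap (L := LOG) RelOG.R xs ↔ relR (xs 0) (xs 1) (xs 2) := by
  rw [relR, iff_eq_eq]
  congr 1
  ext i
  fin_cases i <;> rfl

theorem relMap_E_iff (xs : Fin 3 → S) :
    Structure.RelMap (L := LOG) RelOG.E xs ↔ relE (xs 0) (xs 1) (xs 2) := by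
  rw [relE, iff_eq_eq]
  congr 1
  ext i
  fin_cases i <;> rfl

/-- Two tuples, possibly in different structures, satisfy the same atomic `𝓛`-formulas. -/
def SameAtomic (x : ι → S) (y : ι → T) : Prop :=
  (∀ i j, x i = x j ↔ y i = y j) ∧
    ∀ (n : ℕ) (r : RelOG n) (v : Fin n → ι),
      Structure.RelMap (L := LOG) r (x ∘ v) ↔ Structure.RelMap (L := LOG) r (y ∘ v)

namespace SameAtomic

theorem symm {x : ι → S} {y : ι → T} (h : SameAtomic x y) : SameAtomic y x :=
  ⟨fun i j => (h.1 i j).symm, fun n r v => (h.2 n r v).symm⟩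

theorem trans {x : ι → S} {y : ι → T} {z : ι → U} (h : SameAtomic x y) (h' : SameAtomic y z) :
    SameAtomic x z :=
  ⟨fun i j => (h.1 i j).trans (h'.1 i j), fun n r v => (h.2 n r v).trans (h'.2 n r v)⟩

theorem comp {x : ι → S} {y : ι → T} (h : SameAtomic x y) (f : κ → ι) :
    SameAtomic (x ∘ f) (y ∘ f) :=
  ⟨fun i j => h.1 (f i) (f j), fun n r v => h.2 n r (f ∘ v)⟩

variable {x : ι → S} {y : ι → T} (h : SameAtomic x y)
include h

theorem sortO_iff (i : ι) : sortO (x i) ↔ sortO (y i) := by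
  simpa [relMap_O_iff] using h.2 1 RelOG.O ![i]

theorem sortG_iff (i : ι) : sortG (x i) ↔ sortG (y i) := by
  simpa [relMap_G_iff] using h.2 1 RelOG.G ![i]

theorem sortC_iff (i : ι) : sortC (x i) ↔ sortC (y i) := by
  simpa [relMap_C_iff] using h.2 1 RelOG.C ![i]

theorem relR_iff (i j k : ι) : relR (x i) (x j) (x k) ↔ relR (y i) (y j) (y k) := by
  simpa [relMap_R_iff] using h.2 3 RelOG.R ![i, j, k]

theorem relE_iff (i j k : ι) : relE (x i) (x j) (x k) ↔ relE (y i) (y j) (y k) := by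
  simpa [relMap_E_iff] using h.2 3 RelOG.E ![i, j, k]

end SameAtomic

/-- The universal `𝓛`-consequences of the axioms of `𝒦`. -/
structure OGUniversal (S : Type*) [LOG.Structure S] : Prop where
  cover : ∀ x : S, sortO x ∨ sortG x ∨ sortC x
  not_sortO_sortG : ∀ x : S, sortO x → ¬sortG x
  not_sortO_sortC : ∀ x : S, sortO x → ¬sortC x
  not_sortG_sortC : ∀ x : S, sortG x → ¬sortC x
  relR_sorts : ∀ v w c : S, relR v w c → sortG v ∧ sortG w ∧ sortC c
  relE_sorts : ∀ o v c : S, relE o v c → sortO o ∧ sortG v ∧ sortC c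
  eq_of_sortC : ∀ c d e : S, sortC c → sortC d → sortC e → d ≠ e → c = d ∨ c = e
  relR_symm : ∀ v w c : S, relR v w c → relR w v c
  relR_irrefl : ∀ v c : S, ¬relR v v c
  relR_inj : ∀ v w c d : S, relR v w c → relR v w d → c = d
  not_relE : ∀ o v w c : S, relR v w c → relE o v c → ¬relE o w c

theorem OGUniversal.of_forall_tuple
    (h : ∀ x : Fin 4 → T, ∃ (S : Type w) (_ : LOG.Structure S) (y : Fin 4 → S),
      OGUniversal S ∧ SameAtomic x y) : OGUniversal T where
  cover a := by
    obtain ⟨S, _, y, hS, hy⟩ := h ![a, a, a, a]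
    exact (or_congr (hy.sortO_iff 0) (or_congr (hy.sortG_iff 0) (hy.sortC_iff 0))).2 (hS.cover _)
  not_sortO_sortG a h₁ h₂ := by
    obtain ⟨S, _, y, hS, hy⟩ := h ![a, a, a, a]
    exact hS.not_sortO_sortG _ ((hy.sortO_iff 0).1 h₁) ((hy.sortG_iff 0).1 h₂)
  not_sortO_sortC a h₁ h₂ := by
    obtain ⟨S, _, y, hS, hy⟩ := h ![a, a, a, a]
    exact hS.not_sortO_sortC _ ((hy.sortO_iff 0).1 h₁) ((hy.sortC_iff 0).1 h₂)
  not_sortG_sortC a h₁ h₂ := by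
    obtain ⟨S, _, y, hS, hy⟩ := h ![a, a, a, a]
    exact hS.not_sortG_sortC _ ((hy.sortG_iff 0).1 h₁) ((hy.sortC_iff 0).1 h₂)
  relR_sorts v w c h₁ := by
    obtain ⟨S, _, y, hS, hy⟩ := h ![v, w, c, c]
    exact (and_congr (hy.sortG_iff 0) (and_congr (hy.sortG_iff 1) (hy.sortC_iff 2))).2
      (hS.relR_sorts _ _ _ ((hy.relR_iff 0 1 2).1 h₁))
  relE_sorts v w c h₁ := by
    obtain ⟨S, _, y, hS, hy⟩ := h ![v, w, c, c]
    exact (and_congr (hy.sortO_iff 0) (and_congr (hy.sortG_iff 1) (hy.sortC_iff 2))).2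
      (hS.relE_sorts _ _ _ ((hy.relE_iff 0 1 2).1 h₁))
  eq_of_sortC c d e h₁ h₂ h₃ h₄ := by
    obtain ⟨S, _, y, hS, hy⟩ := h ![c, d, e, e]
    exact (or_congr (hy.1 0 1) (hy.1 0 2)).2 (hS.eq_of_sortC _ _ _ ((hy.sortC_iff 0).1 h₁)
      ((hy.sortC_iff 1).1 h₂) ((hy.sortC_iff 2).1 h₃) ((not_congr (hy.1 1 2)).1 h₄))
  relR_symm v w c h₁ := by
    obtain ⟨S, _, y, hS, hy⟩ := h ![v, w, c, c]
    exact (hy.relR_iff 1 0 2).2 (hS.relR_symm _ _ _ ((hy.relR_iff 0 1 2).1 h₁))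
  relR_irrefl v c h₁ := by
    obtain ⟨S, _, y, hS, hy⟩ := h ![v, c, c, c]
    exact hS.relR_irrefl _ _ ((hy.relR_iff 0 0 1).1 h₁)
  relR_inj v w c d h₁ h₂ := by
    obtain ⟨S, _, y, hS, hy⟩ := h ![v, w, c, d]
    exact (hy.1 2 3).2
      (hS.relR_inj _ _ _ _ ((hy.relR_iff 0 1 2).1 h₁) ((hy.relR_iff 0 1 3).1 h₂))
  not_relE o v w c h₁ h₂ h₃ := by
    obtain ⟨S, _, y, hS, hy⟩ := h ![o, v, w, c]
    exact hS.not_relE _ _ _ _ ((hy.relR_iff 1 2 3).1 h₁) ((hy.relE_iff 0 1 3).1 h₂)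
      ((hy.relE_iff 0 2 3).1 h₃)

variable {P Q B : Type*}

/-- A tuple listing elements of the sorts `O`, `G` and `C`, in this order. -/
structure Sorted (o : P → S) (g : Q → S) (c : B → S) : Prop where
  sortO : ∀ i, sortO (o i)
  sortG : ∀ i, sortG (g i)
  sortC : ∀ i, sortC (c i)

theorem Sorted.relMap_imp (hS : OGUniversal S) {o : P → S} {g : Q → S} {c : B → S}
    (hs : Sorted o g c) {o' : P → T} {g' : Q → T} {c' : B → T} (hs' : Sorted o' g' c')
    (hR : ∀ i j k, relR (g i) (g j) (c k) → relR (g' i) (g' j) (c' k))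
    (hE : ∀ i j k, relE (o i) (g j) (c k) → relE (o' i) (g' j) (c' k))
    (n : ℕ) (r : RelOG n) (v : Fin n → P ⊕ (Q ⊕ B))
    (h : Structure.RelMap (L := LOG) r (Sum.elim o (Sum.elim g c) ∘ v)) :
    Structure.RelMap (L := LOG) r (Sum.elim o' (Sum.elim g' c') ∘ v) := by
  have nO : ∀ i, ¬PaperDiv.sortG (o i) ∧ ¬PaperDiv.sortC (o i) := fun i =>
    ⟨hS.not_sortO_sortG _ (hs.sortO i), hS.not_sortO_sortC _ (hs.sortO i)⟩
  have nG : ∀ i, ¬PaperDiv.sortO (g i) ∧ ¬PaperDiv.sortC (g i) := fun i =>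
    ⟨fun h => hS.not_sortO_sortG _ h (hs.sortG i), hS.not_sortG_sortC _ (hs.sortG i)⟩
  have nC : ∀ i, ¬PaperDiv.sortO (c i) ∧ ¬PaperDiv.sortG (c i) := fun i =>
    ⟨fun h => hS.not_sortO_sortC _ h (hs.sortC i), fun h => hS.not_sortG_sortC _ h (hs.sortC i)⟩
  cases r with
  | O =>
    simp only [relMap_O_iff, Function.comp_apply] at h ⊢
    generalize v 0 = p0 at h ⊢
    rcases p0 with i | i | i
    exacts [hs'.sortO i, ((nG i).1 h).elim, ((nC i).1 h).elim]
  | G =>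
    simp only [relMap_G_iff, Function.comp_apply] at h ⊢
    generalize v 0 = p0 at h ⊢
    rcases p0 with i | i | i
    exacts [((nO i).1 h).elim, hs'.sortG i, ((nC i).2 h).elim]
  | C =>
    simp only [relMap_C_iff, Function.comp_apply] at h ⊢
    generalize v 0 = p0 at h ⊢
    rcases p0 with i | i | i
    exacts [((nO i).2 h).elim, ((nG i).2 h).elim, hs'.sortC i]
  | R =>
    simp only [relMap_R_iff, Function.comp_apply] at h ⊢
    generalize v 0 = p0 at h ⊢
    generalize v 1 = p1 at h ⊢
    generalize v 2 = p2 at h ⊢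
    obtain ⟨h₀, h₁, h₂⟩ := hS.relR_sorts _ _ _ h
    rcases p0 with i | i | i
    · exact ((nO i).1 h₀).elim
    · rcases p1 with j | j | j
      · exact ((nO j).1 h₁).elim
      · rcases p2 with k | k | k
        · exact ((nO k).2 h₂).elim
        · exact ((nG k).2 h₂).elim
        · exact hR i j k h
      · exact ((nC j).2 h₁).elim
    · exact ((nC i).2 h₀).elim
  | E =>
    simp only [relMap_E_iff, Function.comp_apply] at h ⊢
    generalize v 0 = p0 at h ⊢
    generalize v 1 = p1 at h ⊢
    generalize v 2 = p2 at h ⊢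
    obtain ⟨h₀, h₁, h₂⟩ := hS.relE_sorts _ _ _ h
    rcases p0 with i | i | i
    · rcases p1 with j | j | j
      · exact ((nO j).1 h₁).elim
      · rcases p2 with k | k | k
        · exact ((nO k).2 h₂).elim
        · exact ((nG k).2 h₂).elim
        · exact hE i j k h
      · exact ((nC j).2 h₁).elim
    · exact ((nG i).1 h₀).elim
    · exact ((nC i).1 h₀).elim

theorem Sorted.ne (hS : OGUniversal S) {o : P → S} {g : Q → S} {c : B → S} (hs : Sorted o g c) :
    (∀ i j, o i ≠ g j) ∧ (∀ i j, o i ≠ c j) ∧ ∀ i j, g i ≠ c j :=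
  ⟨fun i j e => hS.not_sortO_sortG _ (e ▸ hs.sortO i) (hs.sortG j),
    fun i j e => hS.not_sortO_sortC _ (e ▸ hs.sortO i) (hs.sortC j),
    fun i j e => hS.not_sortG_sortC _ (e ▸ hs.sortG i) (hs.sortC j)⟩

theorem Sorted.sameAtomic (hS : OGUniversal S) (hT : OGUniversal T)
    {o : P → S} {g : Q → S} {c : B → S} (hs : Sorted o g c)
    {o' : P → T} {g' : Q → T} {c' : B → T} (hs' : Sorted o' g' c')
    (ho : ∀ i j, o i = o j ↔ o' i = o' j) (hg : ∀ i j, g i = g j ↔ g' i = g' j)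
    (hc : ∀ i j, c i = c j ↔ c' i = c' j)
    (hR : ∀ i j k, relR (g i) (g j) (c k) ↔ relR (g' i) (g' j) (c' k))
    (hE : ∀ i j k, relE (o i) (g j) (c k) ↔ relE (o' i) (g' j) (c' k)) :
    SameAtomic (Sum.elim o (Sum.elim g c)) (Sum.elim o' (Sum.elim g' c')) := by
  obtain ⟨h₁, h₂, h₃⟩ := hs.ne hS
  obtain ⟨h₁', h₂', h₃'⟩ := hs'.ne hT
  refine ⟨?_, fun n r v => ⟨hs.relMap_imp hS hs' (fun i j k => (hR i j k).1)
    (fun i j k => (hE i j k).1) n r v, hs'.relMap_imp hT hs (fun i j k => (hR i j k).2)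
    (fun i j k => (hE i j k).2) n r v⟩⟩
  rintro (i | i | i) (j | j | j) <;> simp only [Sum.elim_inl, Sum.elim_inr]
  exacts [ho i j, iff_of_false (h₁ i j) (h₁' i j), iff_of_false (h₂ i j) (h₂' i j),
    iff_of_false (h₁ j i).symm (h₁' j i).symm, hg i j, iff_of_false (h₃ i j) (h₃' i j),
    iff_of_false (h₂ j i).symm (h₂' j i).symm, iff_of_false (h₃ j i).symm (h₃' j i).symm, hc i j]

instance : Finite (Σ n, RelOG n) :=
  Finite.of_surjective (fun i : Fin 5 => (![⟨1, .O⟩, ⟨1, .G⟩, ⟨1, .C⟩, ⟨3, .R⟩, ⟨3, .E⟩] :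
    Fin 5 → Σ n, RelOG n) i) (by
    rintro ⟨n, r⟩
    cases r
    exacts [⟨0, rfl⟩, ⟨1, rfl⟩, ⟨2, rfl⟩, ⟨3, rfl⟩, ⟨4, rfl⟩])

open Classical in
/-- The conjunction of all atomic formulas and negated atomic formulas satisfied by a tuple. -/
noncomputable def diagramFormula [Finite ι] (x : ι → S) : LOG.Formula ι :=
  (Formula.iInf fun p : ι × ι => if x p.1 = x p.2 then (Term.var p.1).equal (Term.var p.2)
      else ∼((Term.var p.1).equal (Term.var p.2))) ⊓
    Formula.iInf fun q : Σ r : Σ n, RelOG n, Fin r.1 → ι =>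
      if Structure.RelMap (L := LOG) q.1.2 (x ∘ q.2)
      then Relations.formula (L := LOG) q.1.2 fun i => Term.var (q.2 i)
      else ∼(Relations.formula (L := LOG) q.1.2 fun i => Term.var (q.2 i))

theorem realize_diagramFormula [Finite ι] {x : ι → S} {y : ι → T} :
    (diagramFormula x).Realize y ↔ SameAtomic x y := by
  simp only [diagramFormula, Formula.realize_inf, Formula.realize_iInf, SameAtomic]
  refine and_congr ⟨fun h i j => ?_, fun h p => ?_⟩ ⟨fun h n r v => ?_, fun h q => ?_⟩
  · have := h (i, j)
    split_ifs at this with hx <;> simp_all [Formula.realize_equal, Formula.realize_not]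
  · split_ifs with hx <;>
      simpa [Formula.realize_equal, Formula.realize_not, h p.1 p.2] using hx
  · have := h ⟨⟨n, r⟩, v⟩
    split_ifs at this with hx
    · rw [Formula.realize_rel] at this
      exact iff_of_true hx this
    · rw [Formula.realize_not, Formula.realize_rel] at this
      exact iff_of_false hx this
  · split_ifs with hx
    · rw [Formula.realize_rel]
      exact (h _ _ _).1 hx
    · rw [Formula.realize_not, Formula.realize_rel]
      exact fun h' => hx ((h _ _ _).2 h')

end AtomicTypes

section FraisseLimit

/-- Every `𝓛'`-structure is regarded as an `𝓛`-structure by forgetting the constants. -/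
abbrev ogReduct (S : Type*) [LOG'.Structure S] : LOG.Structure S := redOG.reduct S

attribute [local instance] ogReduct

section Embeddings

variable {S T : Type*} [LOG'.Structure S] [LOG'.Structure T]

theorem funMap_zero (xs : Fin 0 → S) : Structure.funMap (L := LOG') FnOG.zero xs = ogZero :=
  congrArg _ (Subsingleton.elim _ _)

theorem funMap_one (xs : Fin 0 → S) : Structure.funMap (L := LOG') FnOG.one xs = ogOne :=
  congrArg _ (Subsingleton.elim _ _)

theorem map_funMap_of_map_constants {f : S → T} (h0 : f ogZero = ogZero) (h1 : f ogOne = ogOne)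
    {n : ℕ} (r : LOG'.Functions n) (xs : Fin n → S) :
    f (Structure.funMap r xs) = Structure.funMap r (f ∘ xs) := by
  cases r with
  | zero => rw [funMap_zero, funMap_zero, h0]
  | one => rw [funMap_one, funMap_one, h1]

theorem embedding_ogZero (f : S ↪[LOG'] T) : f ogZero = ogZero := by
  rw [ogZero, f.map_fun, funMap_zero]

theorem embedding_ogOne (f : S ↪[LOG'] T) : f ogOne = ogOne := by
  rw [ogOne, f.map_fun, funMap_one]

theorem sameAtomic_embedding (f : S ↪[LOG'] T) : SameAtomic (id : S → S) f :=
  ⟨fun _ _ => f.injective.eq_iff.symm, fun _ r v => (f.map_rel r v).symm⟩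

/-- An embedding of reducts that fixes the constants is an embedding of `𝓛'`-structures. -/
def embeddingOfSameAtomic (f : S → T) (h : SameAtomic (id : S → S) f) (h0 : f ogZero = ogZero)
    (h1 : f ogOne = ogOne) : S ↪[LOG'] T where
  toFun := f
  inj' i j hij := (h.1 i j).2 hij
  map_fun' r xs := map_funMap_of_map_constants h0 h1 r xs
  map_rel' r xs := (h.2 _ r xs).symm

theorem finite_of_fg (h : Structure.FG LOG' S) : Finite S := by
  obtain ⟨t, ht, ht'⟩ := Structure.fg_iff.1 h
  let A : LOG'.Substructure S :=
    { carrier := t ∪ {ogZero, ogOne}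
      fun_mem := fun r xs _ => by
        cases r with
        | zero => rw [funMap_zero]; simp
        | one => rw [funMap_one]; simp }
  have hA : (⊤ : LOG'.Substructure S) ≤ A := by
    rw [← ht', Substructure.closure_le]
    exact subset_union_left
  have hfin : (Set.univ : Set S).Finite :=
    (ht.union (toFinite {ogZero, ogOne})).subset fun x _ => hA (Substructure.mem_top x)
  exact finite_univ_iff.1 hfin

theorem OGAxioms.universal (h : OGAxioms S) : OGUniversal S := by
  obtain ⟨h1, h2, h3, h4, h5, h6, h7, h8, h9, h10, h11, h12⟩ := h
  refine ⟨h1, fun x a b => (h2 x).1 ⟨a, b⟩, fun x a b => (h2 x).2.1 ⟨a, b⟩,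
    fun x a b => (h2 x).2.2 ⟨a, b⟩, h3, h4, ?_, h9, h10, ?_, fun o v w c h a b =>
    h12 v w c h ⟨o, a, b⟩⟩
  · intro c d e hc hd he hde
    rcases h8 c hc with rfl | rfl <;> rcases h8 d hd with rfl | rfl <;>
      rcases h8 e he with rfl | rfl <;> simp_all
  · intro v w c d hc hd
    rcases h8 c (h3 _ _ _ hc).2.2 with rfl | rfl <;> rcases h8 d (h3 _ _ _ hd).2.2 with rfl | rfl
    exacts [rfl, (h11 v w ⟨hc, hd⟩).elim, (h11 v w ⟨hd, hc⟩).elim, rfl]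

end Embeddings

/-- The same `𝓛`-structure with the interpretations of the constants `0` and `1` exchanged. -/
def Swapped (S : Type*) : Type _ := S

instance (S : Type*) [Countable S] : Countable (Swapped S) := ‹Countable S›

instance (S : Type*) [LOG'.Structure S] : LOG'.Structure (Swapped S) where
  funMap {_} r _ := match r with
    | .zero => (ogOne : S)
    | .one => (ogZero : S)
  RelMap {_} r xs := Structure.RelMap (L := LOG') (M := S) r xs

theorem ogAxioms_swapped {S : Type*} [LOG'.Structure S] : OGAxioms (Swapped S) ↔ OGAxioms S := by
  constructor <;>
  · rintro ⟨h1, h2, h3, h4, h5, h6, h7, h8, h9, h10, h11, h12⟩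
    exact ⟨h1, h2, h3, h4, h5.symm, h7, h6, fun c hc => (h8 c hc).symm, h9, h10,
      fun v w h => h11 v w h.symm, h12⟩

variable {M : Type w} [LOG'.Structure M] [Countable M]

theorem age_iff (hlim : IsFraisseLimit KOG M) (S : Type w) [LOG'.Structure S] [Finite S] :
    Nonempty (S ↪[LOG'] M) ↔ OGAxioms S := by
  have h := Set.ext_iff.1 hlim.age ⟨S, ‹_›⟩
  refine ⟨fun hS => (h.1 ⟨Structure.FG.of_finite, hS⟩).2, fun hS => (h.2 ⟨‹_›, hS⟩).2⟩

theorem isFraisseLimit_swapped (hlim : IsFraisseLimit KOG M) :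
    IsFraisseLimit KOG (Swapped M) where
  age := by
    ext ⟨S, hS⟩
    have hiff : Nonempty (S ↪[LOG'] Swapped M) ↔ Nonempty (Swapped S ↪[LOG'] M) :=
      ⟨fun ⟨f⟩ => ⟨embeddingOfSameAtomic (S := Swapped S) (T := M) f (sameAtomic_embedding f)
          (embedding_ogOne f) (embedding_ogZero f)⟩,
        fun ⟨f⟩ => ⟨embeddingOfSameAtomic (S := S) (T := Swapped M) f (sameAtomic_embedding f)
          (embedding_ogOne f) (embedding_ogZero f)⟩⟩
    constructor
    · rintro ⟨hfg, hf⟩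
      have : Finite S := finite_of_fg hfg
      have : Finite (Swapped S) := this
      exact ⟨‹Finite S›, ogAxioms_swapped.1 ((age_iff hlim (Swapped S)).1 (hiff.1 hf))⟩
    · rintro ⟨hfin, hax⟩
      have : Finite S := hfin
      have : Finite (Swapped S) := this
      exact ⟨Structure.FG.of_finite, hiff.2 ((age_iff hlim (Swapped S)).2 (ogAxioms_swapped.2 hax))⟩
  ultrahomogeneous := by
    intro A hA f
    have hfinA : Finite A := finite_of_fg (A.fg_iff_structure_fg.1 hA)
    have h0 : (ogZero : Swapped M) ∈ A := A.fun_mem FnOG.zero ![] (fun i => i.elim0)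
    have h1 : (ogOne : Swapped M) ∈ A := A.fun_mem FnOG.one ![] (fun i => i.elim0)
    let A' : LOG'.Substructure M :=
      { carrier := (A : Set (Swapped M))
        fun_mem := fun r xs _ => by
          cases r with
          | zero => rw [funMap_zero]; exact h1
          | one => rw [funMap_one]; exact h0 }
    have : Finite A' := hfinA
    have hz : (ogZero : A') = (ogOne : A) := Subtype.ext
      ((embedding_ogZero A'.subtype).trans (embedding_ogOne A.subtype).symm)
    have ho : (ogOne : A') = (ogZero : A) := Subtype.ext
      ((embedding_ogOne A'.subtype).trans (embedding_ogZero A.subtype).symm)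
    obtain ⟨g, hg⟩ := hlim.ultrahomogeneous A' Substructure.FG.of_finite
      (embeddingOfSameAtomic (S := A') (T := M) f (sameAtomic_embedding f)
        ((congrArg f hz).trans (embedding_ogOne f)) ((congrArg f ho).trans (embedding_ogZero f)))
    refine ⟨⟨g.toEquiv, fun r xs => ?_, fun r xs => g.map_rel r xs⟩, ?_⟩
    · exact map_funMap_of_map_constants (S := Swapped M) (T := Swapped M)
        (embedding_ogOne g.toEmbedding) (embedding_ogZero g.toEmbedding) r xs
    · ext x
      exact DFunLike.congr_fun hg x

variable {ι : Type*}

/-- An isomorphism of `𝓛'`-structures is an isomorphism of their `𝓛`-reducts. -/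
def reductEquiv {S T : Type*} [LOG'.Structure S] [LOG'.Structure T] (σ : S ≃[LOG'] T) :
    S ≃[LOG] T where
  toEquiv := σ.toEquiv
  map_fun' r := r.elim
  map_rel' r xs := σ.map_rel r xs

theorem exists_equiv_of_sameAtomic_of_constants [Finite ι] (hlim : IsFraisseLimit KOG M)
    {x y : ι → M} (h : SameAtomic x y) {u v : ι} (hxu : x u = ogZero) (hxv : x v = ogOne)
    (hyu : y u = ogZero) (hyv : y v = ogOne) : ∃ σ : M ≃[LOG] M, ∀ i, σ (x i) = y i := by
  let A : LOG'.Substructure M :=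
    { carrier := range x
      fun_mem := fun r xs _ => by
        cases r with
        | zero => rw [funMap_zero]; exact ⟨u, hxu⟩
        | one => rw [funMap_one]; exact ⟨v, hxv⟩ }
  have : Finite A := (finite_range x).to_subtype
  choose p hp using fun a : A => a.2
  have hx : SameAtomic (id : A → A) (x ∘ p) := by
    have : x ∘ p = A.subtype := funext hp
    rw [this]
    exact sameAtomic_embedding A.subtype
  have hf : ∀ (a : A) (i : ι), (a : M) = x i → y (p a) = y i := fun a i hi =>
    (h.1 _ _).1 ((hp a).trans hi)
  obtain ⟨g, hg⟩ := hlim.ultrahomogeneous A Substructure.FG.of_finite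
    (embeddingOfSameAtomic (y ∘ p) (hx.trans (h.comp p))
      ((hf _ u ((embedding_ogZero A.subtype).trans hxu.symm)).trans hyu)
      ((hf _ v ((embedding_ogOne A.subtype).trans hxv.symm)).trans hyv))
  refine ⟨reductEquiv g, fun i => ?_⟩
  exact (DFunLike.congr_fun hg ⟨x i, i, rfl⟩).symm.trans (hf ⟨x i, i, rfl⟩ i rfl)

theorem ogAxioms_closure (hlim : IsFraisseLimit KOG M) {t : Set M} (ht : t.Finite) :
    OGAxioms (Substructure.closure LOG' t) := by
  have hfg := (Substructure.fg_iff_structure_fg _).1 (Substructure.fg_closure (L := LOG') ht)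
  have : Finite (Substructure.closure LOG' t) := finite_of_fg hfg
  exact (age_iff hlim _).1 ⟨Substructure.subtype _⟩

theorem ogUniversal_of_isFraisseLimit (hlim : IsFraisseLimit KOG M) : OGUniversal M := by
  refine OGUniversal.of_forall_tuple fun x => ?_
  let A := Substructure.closure LOG' (range x)
  exact ⟨A, ogReduct A, fun i => ⟨x i, Substructure.subset_closure ⟨i, rfl⟩⟩,
    (ogAxioms_closure hlim (finite_range x)).universal,
    ((sameAtomic_embedding A.subtype).comp
      fun i => ⟨x i, Substructure.subset_closure ⟨i, rfl⟩⟩).symm⟩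

theorem constants_of_isFraisseLimit (hlim : IsFraisseLimit KOG M) :
    (ogZero : M) ≠ ogOne ∧ sortC (ogZero : M) ∧ sortC (ogOne : M) := by
  obtain ⟨-, -, -, -, h5, h6, h7, -⟩ := ogAxioms_closure hlim (t := ∅) finite_empty
  have hf := (Substructure.closure LOG' (∅ : Set M)).subtype
  have h := sameAtomic_embedding hf
  rw [← embedding_ogZero hf, ← embedding_ogOne hf]
  exact ⟨fun e => h5 (hf.injective e), (h.sortC_iff ogZero).1 h6, (h.sortC_iff ogOne).1 h7⟩

theorem exists_equiv_of_sameAtomic [Finite ι] (hlim : IsFraisseLimit KOG M)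
    {x y : ι → M} (h : SameAtomic x y) {u v : ι} (huv : x u ≠ x v) (hu : sortC (x u))
    (hv : sortC (x v)) : ∃ σ : M ≃[LOG] M, ∀ i, σ (x i) = y i := by
  have hM := ogUniversal_of_isFraisseLimit hlim
  obtain ⟨hne, h0, h1⟩ := constants_of_isFraisseLimit hlim
  have key : ∀ {c d : M}, c ≠ d → sortC c → sortC d →
      c = ogZero ∧ d = ogOne ∨ c = ogOne ∧ d = ogZero := fun {c d} hcd hc hd => by
    rcases hM.eq_of_sortC c _ _ hc h0 h1 hne with rfl | rfl <;>
      rcases hM.eq_of_sortC d _ _ hd h0 h1 hne with rfl | rfl <;> simp_all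
  obtain ⟨τ⟩ := hlim.nonempty_equiv (isFraisseLimit_swapped hlim)
  let τ' : M ≃[LOG] M := ⟨(reductEquiv τ).toEquiv, fun r => r.elim, fun r xs => τ.map_rel r xs⟩
  have hτ0 : τ' ogZero = ogOne := embedding_ogZero τ.toEmbedding
  have hτ1 : τ' ogOne = ogZero := embedding_ogOne τ.toEmbedding
  have hτ : SameAtomic x (τ' ∘ x) :=
    ⟨fun i j => τ'.injective.eq_iff.symm, fun n r xs => (τ'.map_rel r (x ∘ xs)).symm⟩
  have hyuv : y u ≠ y v := (not_congr (h.1 u v)).1 huv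
  rcases key huv hu hv with ⟨e₁, e₂⟩ | ⟨e₁, e₂⟩ <;>
    rcases key hyuv ((h.sortC_iff u).1 hu) ((h.sortC_iff v).1 hv) with ⟨e₃, e₄⟩ | ⟨e₃, e₄⟩
  · exact exists_equiv_of_sameAtomic_of_constants hlim h e₁ e₂ e₃ e₄
  · obtain ⟨σ, hσ⟩ := exists_equiv_of_sameAtomic_of_constants hlim (hτ.symm.trans h) (u := v)
      (v := u) (by simp [e₂, hτ1]) (by simp [e₁, hτ0]) e₄ e₃
    exact ⟨σ.comp τ', hσ⟩
  · obtain ⟨σ, hσ⟩ := exists_equiv_of_sameAtomic_of_constants hlim (hτ.symm.trans h) (u := u)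
      (v := v) (by simp [e₁, hτ1]) (by simp [e₂, hτ0]) e₃ e₄
    exact ⟨σ.comp τ', hσ⟩
  · exact exists_equiv_of_sameAtomic_of_constants hlim h e₂ e₁ e₄ e₃

end FraisseLimit

section Transfer

attribute [local instance] ogReduct

variable {M : Type w} [LOG'.Structure M] {N : Type w} [LOG.Structure N] {ι : Type*} [Finite ι]

theorem exists_realize_iff_of_model_TOG [hN : (TOG M).Model N] (φ : LOG.Formula ι) :
    (∃ x : ι → N, φ.Realize x) ↔ ∃ x : ι → M, φ.Realize x := by
  let ψ : LOG.Formula (Empty ⊕ ι) := φ.relabel Sum.inr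
  have key : ∀ (S : Type w) [LOG.Structure S],
      S ⊨ (ψ.iExs ι : LOG.Sentence) ↔ ∃ x : ι → S, φ.Realize x := fun S _ => by
    rw [Sentence.Realize, Formula.realize_iExs]
    refine exists_congr fun x => ?_
    rw [Formula.realize_relabel]
    rfl
  have : N ⊨ LOG.completeTheory M := hN
  rw [← key N, ← key M]
  exact realize_iff_of_model_completeTheory M N _

theorem exists_sameAtomic_of_model_TOG (M : Type w) [LOG'.Structure M] [(TOG M).Model N]
    (x : ι → N) : ∃ y : ι → M, SameAtomic x y := by
  obtain ⟨y, hy⟩ := (exists_realize_iff_of_model_TOG (M := M) (diagramFormula x)).1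
    ⟨x, realize_diagramFormula.2 ⟨fun _ _ => Iff.rfl, fun _ _ _ => Iff.rfl⟩⟩
  exact ⟨y, realize_diagramFormula.1 hy⟩

theorem exists_sameAtomic_in_model_TOG [(TOG M).Model N] (x : ι → M) :
    ∃ y : ι → N, SameAtomic x y := by
  obtain ⟨y, hy⟩ := (exists_realize_iff_of_model_TOG (M := M) (N := N) (diagramFormula x)).2
    ⟨x, realize_diagramFormula.2 ⟨fun _ _ => Iff.rfl, fun _ _ _ => Iff.rfl⟩⟩
  exact ⟨y, realize_diagramFormula.1 hy⟩

variable [Countable M]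

theorem ogUniversal_of_model_TOG (hlim : IsFraisseLimit KOG M) [(TOG M).Model N] :
    OGUniversal N := by
  refine OGUniversal.of_forall_tuple fun x => ?_
  obtain ⟨y, hy⟩ := exists_sameAtomic_of_model_TOG M x
  exact ⟨M, ogReduct M, y, ogUniversal_of_isFraisseLimit hlim, hy⟩

/-- Quantifier elimination, with both elements of sort `C` named. -/
theorem realize_iff_of_sameAtomic (hlim : IsFraisseLimit KOG M) [(TOG M).Model N]
    {x y : ι → N} (h : SameAtomic x y) {u v : ι} (huv : x u ≠ x v) (hu : sortC (x u))
    (hv : sortC (x v)) (φ : LOG.Formula ι) : φ.Realize x ↔ φ.Realize y := by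
  have main : ∀ {x y : ι → N}, SameAtomic x y → x u ≠ x v → sortC (x u) → sortC (x v) →
      φ.Realize x → φ.Realize y := by
    intro x y h huv hu hv hφ
    by_contra hy
    obtain ⟨z, hz⟩ := (exists_realize_iff_of_model_TOG (M := M)
      (diagramFormula (Sum.elim x y) ⊓ φ.relabel Sum.inl ⊓ ∼(φ.relabel Sum.inr))).1
      ⟨Sum.elim x y, by
        simp only [Formula.realize_inf, Formula.realize_not, Formula.realize_relabel,
          realize_diagramFormula, Sum.elim_comp_inl, Sum.elim_comp_inr]
        exact ⟨⟨⟨fun _ _ => Iff.rfl, fun _ _ _ => Iff.rfl⟩, hφ⟩, hy⟩⟩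
    simp only [Formula.realize_inf, Formula.realize_not, Formula.realize_relabel,
      realize_diagramFormula] at hz
    obtain ⟨⟨hz, hz₁⟩, hz₂⟩ := hz
    have hzx : SameAtomic x (z ∘ Sum.inl) := hz.comp Sum.inl
    have hzy : SameAtomic y (z ∘ Sum.inr) := hz.comp Sum.inr
    obtain ⟨σ, hσ⟩ := exists_equiv_of_sameAtomic hlim (hzx.symm.trans (h.trans hzy))
      ((not_congr (hzx.1 u v)).1 huv) ((hzx.sortC_iff u).1 hu) ((hzx.sortC_iff v).1 hv)
    have : σ ∘ (z ∘ Sum.inl) = z ∘ Sum.inr := funext hσ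
    rw [← this] at hz₂
    exact hz₂ ((StrongHomClass.realize_formula σ φ).2 hz₁)
  exact ⟨main h huv hu hv, main h.symm ((not_congr (h.1 u v)).1 huv) ((h.sortC_iff u).1 hu)
    ((h.sortC_iff v).1 hv)⟩

theorem exists_aut_of_sameAtomic (hlim : IsFraisseLimit KOG M) [(TOG M).Model N]
    {κ : Cardinal.{w}} (hN : IsMonster LOG N κ) {x y : ι → N} (h : SameAtomic x y) {u v : ι}
    (huv : x u ≠ x v) (hu : sortC (x u)) (hv : sortC (x v)) :
    ∃ σ : N ≃[LOG] N, ∀ i, σ (x i) = y i := by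
  obtain ⟨n, ⟨e⟩⟩ := Finite.exists_equiv_fin ι
  have hfin : ∀ (X : Type w) [Finite X], #X < κ := fun X _ =>
    (Cardinal.lt_aleph0_of_finite X).trans hN.aleph0_lt
  have htype : SameType LOG N ∅ (fun i : ULift.{w} (Fin n) => x (e.symm i.down))
      (fun i => y (e.symm i.down)) := by
    intro m φ c hc
    cases m with
    | succ m => exact (hc 0).elim
    | zero =>
      have key := realize_iff_of_sameAtomic hlim h huv hu hv
        (φ.relabel (Sum.elim (fun i => e.symm i.down) fun i => i.elim0))
      simp only [Formula.realize_relabel] at key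
      convert key using 2 <;>
      · ext (i | i)
        · rfl
        · exact i.elim0
  obtain ⟨σ, -, hσ⟩ := hN.homogeneous ∅ _ _ (hfin _) (hfin _) htype
  exact ⟨σ, fun i => by simpa using hσ ⟨e i⟩⟩

section Configurations

variable {P Q : Type w}

/-- The `𝓛'`-structure with sorts `P`, `Q` and `Bool` and prescribed relations. -/
abbrev configStructure (R : Q → Q → Bool → Prop) (E : P → Q → Bool → Prop) :
    LOG'.Structure (P ⊕ (Q ⊕ Bool)) where
  funMap {_} r _ := match r with
    | .zero => .inr (.inr false)
    | .one => .inr (.inr true)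
  RelMap {_} r xs := match r, xs with
    | .O, xs => ∃ i, xs 0 = .inl i
    | .G, xs => ∃ i, xs 0 = .inr (.inl i)
    | .C, xs => ∃ i, xs 0 = .inr (.inr i)
    | .R, xs => ∃ i j k, R i j k ∧
      xs 0 = .inr (.inl i) ∧ xs 1 = .inr (.inl j) ∧ xs 2 = .inr (.inr k)
    | .E, xs => ∃ i j k, E i j k ∧
      xs 0 = .inl i ∧ xs 1 = .inr (.inl j) ∧ xs 2 = .inr (.inr k)

theorem exists_configuration (hlim : IsFraisseLimit KOG M) [(TOG M).Model N] [Finite P] [Finite Q]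
    (R : Q → Q → Bool → Prop) (E : P → Q → Bool → Prop)
    (hsymm : ∀ i j k, R i j k → R j i k) (hirrefl : ∀ i k, ¬R i i k)
    (hdisj : ∀ i j, ¬(R i j false ∧ R i j true))
    (hRE : ∀ p i j k, R i j k → E p i k → ¬E p j k) :
    ∃ (o : P → N) (g : Q → N) (c : Bool → N), Sorted o g c ∧ o.Injective ∧ g.Injective ∧
      c false ≠ c true ∧ (∀ i j k, relR (g i) (g j) (c k) ↔ R i j k) ∧
      ∀ i j k, relE (o i) (g j) (c k) ↔ E i j k := by
  let := configStructure R E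
  have hax : OGAxioms (P ⊕ (Q ⊕ Bool)) := by
    have hO : ∀ x : P ⊕ (Q ⊕ Bool), sortO' x ↔ ∃ i, x = .inl i := fun _ => Iff.rfl
    have hG : ∀ x : P ⊕ (Q ⊕ Bool), sortG' x ↔ ∃ i, x = .inr (.inl i) := fun _ => Iff.rfl
    have hC : ∀ x : P ⊕ (Q ⊕ Bool), sortC' x ↔ ∃ i, x = .inr (.inr i) := fun _ => Iff.rfl
    have hR : ∀ x y z : P ⊕ (Q ⊕ Bool), relR' x y z ↔ ∃ i j k, R i j k ∧
      x = .inr (.inl i) ∧ y = .inr (.inl j) ∧ z = .inr (.inr k) := fun _ _ _ => Iff.rfl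
    have hE : ∀ x y z : P ⊕ (Q ⊕ Bool), relE' x y z ↔ ∃ i j k, E i j k ∧
      x = .inl i ∧ y = .inr (.inl j) ∧ z = .inr (.inr k) := fun _ _ _ => Iff.rfl
    have h0 : (ogZero : P ⊕ (Q ⊕ Bool)) = .inr (.inr false) := rfl
    have h1 : (ogOne : P ⊕ (Q ⊕ Bool)) = .inr (.inr true) := rfl
    simp only [OGAxioms, hO, hG, hC, hR, hE, h0, h1]
    refine ⟨?_, ?_, ?_, ?_, by simp, by simp, by simp, ?_, ?_, ?_, ?_, ?_⟩
    · rintro (i | i | i) <;> simp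
    · rintro (i | i | i) <;> simp
    · rintro _ _ _ ⟨i, j, k, -, rfl, rfl, rfl⟩
      simp
    · rintro _ _ _ ⟨i, j, k, -, rfl, rfl, rfl⟩
      simp
    · rintro _ ⟨_ | _, rfl⟩ <;> simp
    · rintro _ _ _ ⟨i, j, k, h, rfl, rfl, rfl⟩
      exact ⟨j, i, k, hsymm _ _ _ h, rfl, rfl, rfl⟩
    · rintro v c ⟨i, j, k, h, rfl, hij, -⟩
      cases hij
      exact hirrefl _ _ h
    · rintro v w ⟨⟨i, j, k, h, rfl, rfl, hk⟩, i', j', k', h', hi, hj, hk'⟩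
      cases hi; cases hj; cases hk; cases hk'
      exact hdisj _ _ ⟨h, h'⟩
    · rintro v w c ⟨i, j, k, h, rfl, rfl, rfl⟩ ⟨o, ⟨p, i', k', h', rfl, hi, hk⟩,
        p', j', k'', h'', hp, hj, hk'⟩
      cases hi; cases hj; cases hk; cases hk'; cases hp
      exact hRE _ _ _ _ h h' h''
  obtain ⟨f⟩ := (age_iff hlim _).2 hax
  obtain ⟨y, hy⟩ := exists_sameAtomic_in_model_TOG (N := N) f
  have h : SameAtomic id y := (sameAtomic_embedding f).trans hy
  refine ⟨y ∘ .inl, y ∘ .inr ∘ .inl, y ∘ .inr ∘ .inr,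
    ⟨fun i => (h.sortO_iff _).1 ⟨i, rfl⟩, fun i => (h.sortG_iff _).1 ⟨i, rfl⟩,
      fun i => (h.sortC_iff _).1 ⟨i, rfl⟩⟩, fun i j e => Sum.inl_injective ((h.1 _ _).2 e),
    fun i j e => Sum.inl_injective (Sum.inr_injective ((h.1 _ _).2 e)), fun e => ?_,
    fun i j k => (h.relR_iff _ _ _).symm.trans ⟨?_, fun hR => ⟨i, j, k, hR, rfl, rfl, rfl⟩⟩,
    fun i j k => (h.relE_iff _ _ _).symm.trans ⟨?_, fun hE => ⟨i, j, k, hE, rfl, rfl, rfl⟩⟩⟩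
  · cases (h.1 _ _).2 e
  · rintro ⟨i', j', k', hR, hi, hj, hk⟩
    cases hi; cases hj; cases hk
    exact hR
  · rintro ⟨i', j', k', hE, hi, hj, hk⟩
    cases hi; cases hj; cases hk
    exact hE

end Configurations

end Transfer

section Formulas

variable {ι S : Type*} [LOG.Structure S]

/-- The atomic formula `R(xᵢ, xⱼ, xₖ)`. -/
def formulaR (i j k : ι) : LOG.Formula ι :=
  Relations.formula (L := LOG) RelOG.R fun t => Term.var (![i, j, k] t)

/-- The atomic formula `E(xᵢ, xⱼ, xₖ)`. -/
def formulaE (i j k : ι) : LOG.Formula ι :=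
  Relations.formula (L := LOG) RelOG.E fun t => Term.var (![i, j, k] t)

/-- The atomic formula `C(xᵢ)`. -/
def formulaC (i : ι) : LOG.Formula ι :=
  Relations.formula (L := LOG) RelOG.C fun _ => Term.var i

theorem realize_formulaR {i j k : ι} {x : ι → S} :
    (formulaR i j k).Realize x ↔ relR (x i) (x j) (x k) := by
  rw [formulaR, Formula.realize_rel, relMap_R_iff]
  rfl

theorem realize_formulaE {i j k : ι} {x : ι → S} :
    (formulaE i j k).Realize x ↔ relE (x i) (x j) (x k) := by
  rw [formulaE, Formula.realize_rel, relMap_E_iff]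
  rfl

theorem realize_formulaC {i : ι} {x : ι → S} :
    (formulaC i).Realize x ↔ sortC (x i) := by
  rw [formulaC, Formula.realize_rel, relMap_C_iff]
  rfl

end Formulas

theorem sameAtomic_equiv {S T : Type*} [LOG.Structure S] [LOG.Structure T] (σ : S ≃[LOG] T) :
    SameAtomic (id : S → S) σ :=
  ⟨fun _ _ => σ.injective.eq_iff.symm, fun _ r v => (σ.map_rel r v).symm⟩

section Monster

variable {M : Type w} [LOG'.Structure M] [Countable M] (hlim : IsFraisseLimit KOG M)
  {N : Type w} [LOG.Structure N] [(TOG M).Model N] {κ : Cardinal.{w}} (hN : IsMonster LOG N κ)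

include hlim

theorem infinite_sorts : {x : N | sortO x}.Infinite ∧ {x : N | sortG x}.Infinite := by
  have key : ∀ X : Set N, (∀ n : ℕ, ∃ f : ULift.{w} (Fin n) → N, f.Injective ∧ ∀ i, f i ∈ X) →
      X.Infinite := fun X h hX => by
    have := hX.to_subtype
    obtain ⟨f, hf, hfX⟩ := h (Nat.card X + 1)
    have := Nat.card_le_card_of_injective (fun i => (⟨f i, hfX i⟩ : X))
      fun i j e => hf (congrArg Subtype.val e)
    simp at this
  refine ⟨key _ fun n => ?_, key _ fun n => ?_⟩
  · obtain ⟨o, _, _, hs, ho, -⟩ := exists_configuration (N := N) hlim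
      (P := ULift.{w} (Fin n)) (Q := PEmpty.{w + 1}) (fun _ _ _ => False)
      (fun _ _ _ => False) (by simp) (by simp) (by simp) (by simp)
    exact ⟨o, ho, hs.sortO⟩
  · obtain ⟨_, g, _, hs, -, hg, -⟩ := exists_configuration (N := N) hlim
      (P := PEmpty.{w + 1}) (Q := ULift.{w} (Fin n)) (fun _ _ _ => False)
      (fun _ _ _ => False) (by simp) (by simp) (by simp) (by simp)
    exact ⟨g, hg, hs.sortG⟩

include hN

/-- Sorted tuples naming both elements of sort `C` and with the same relations are conjugate. -/
theorem Sorted.exists_aut {P Q : Type*} [Finite P] [Finite Q]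
    {o o' : P → N} {g g' : Q → N} {c c' : Bool → N} (hs : Sorted o g c) (hs' : Sorted o' g' c')
    (ho : ∀ i j, o i = o j ↔ o' i = o' j) (hg : ∀ i j, g i = g j ↔ g' i = g' j)
    (hc : c false ≠ c true) (hc' : c' false ≠ c' true)
    (hR : ∀ i j k, relR (g i) (g j) (c k) ↔ relR (g' i) (g' j) (c' k))
    (hE : ∀ i j k, relE (o i) (g j) (c k) ↔ relE (o' i) (g' j) (c' k)) :
    ∃ σ : N ≃[LOG] N, (∀ i, σ (o i) = o' i) ∧ (∀ i, σ (g i) = g' i) ∧ ∀ i, σ (c i) = c' i := by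
  have hU := ogUniversal_of_model_TOG (N := N) hlim
  have h := hs.sameAtomic hU hU hs' ho hg
    (by rintro (_ | _) (_ | _) <;> simp [hc, hc', hc.symm, hc'.symm]) hR hE
  obtain ⟨σ, hσ⟩ := exists_aut_of_sameAtomic hlim hN h (u := .inr (.inr false))
    (v := .inr (.inr true)) hc (hs.sortC false) (hs.sortC true)
  exact ⟨σ, fun i => hσ (.inl i), fun i => hσ (.inr (.inl i)), fun i => hσ (.inr (.inr i))⟩

variable {c d : N} (hcd : c ≠ d) (hc : sortC c) (hd : sortC d)
include hcd hc hd

/-- If there are no `R(·, ·, c)`-edges within a finite set of vertices, then some `o` is related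
to all of them by `E(o, ·, c)` and to none of them by `E(o, ·, d)`. -/
theorem exists_relE_of_forall_not_relR {D : Set N} (hD : D.Finite) (hG : ∀ v ∈ D, sortG v)
    (hR : ∀ v ∈ D, ∀ w ∈ D, ¬relR v w c) :
    ∃ o : N, sortO o ∧ ∀ v ∈ D, relE o v c ∧ ¬relE o v d := by
  have hU := ogUniversal_of_model_TOG (N := N) hlim
  have := hD.to_subtype
  obtain ⟨o, g, c', hs, -, hg, hc', hR', hE'⟩ := exists_configuration (N := N) hlim
    (P := PUnit.{w + 1}) (Q := D) (fun v w k => relR (v : N) w (bif k then d else c))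
    (fun _ _ k => k = false) (fun _ _ _ h => hU.relR_symm _ _ _ h)
    (fun _ _ h => hU.relR_irrefl _ _ h) (fun _ _ h => hcd (hU.relR_inj _ _ _ _ h.1 h.2))
    (fun _ v w k h hk => by subst hk; exact (hR v v.2 w w.2 h).elim)
  obtain ⟨σ, -, hσg, hσc⟩ := Sorted.exists_aut hlim hN (P := Empty) (o := Empty.elim)
    (o' := Empty.elim) (g := g) (c := c') (g' := fun v : D => (v : N))
    (c' := fun k => bif k then d else c) ⟨fun i => i.elim, hs.sortG, hs.sortC⟩
    ⟨fun i => i.elim, fun v => hG v v.2, by rintro (_ | _) <;> assumption⟩ (fun i => i.elim)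
    (fun i j => hg.eq_iff.trans Subtype.ext_iff) hc' hcd hR' (fun i => i.elim)
  have hσ := sameAtomic_equiv σ
  refine ⟨σ (o ⟨⟩), (hσ.sortO_iff _).1 (hs.sortO _), fun v hv => ?_⟩
  have h0 := (hσ.relE_iff (o ⟨⟩) (g ⟨v, hv⟩) (c' false)).symm.trans (hE' ⟨⟩ ⟨v, hv⟩ false)
  have h1 := (hσ.relE_iff (o ⟨⟩) (g ⟨v, hv⟩) (c' true)).symm.trans (hE' ⟨⟩ ⟨v, hv⟩ true)
  rw [hσg, hσc] at h0 h1
  exact ⟨h0.2 rfl, fun h => Bool.noConfusion (h1.1 h)⟩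

theorem exists_finite_clique (n : ℕ) :
    ∃ e : Fin n → N, (∀ i, sortG (e i)) ∧ ∀ i j, i ≠ j → relR (e i) (e j) c := by
  obtain ⟨o, g, c', hs, -, hg, hc', hR', -⟩ := exists_configuration (N := N) hlim
    (P := PEmpty.{w + 1}) (Q := ULift.{w} (Fin n)) (fun v w k => v ≠ w ∧ k = false)
    (fun _ _ _ => True) (fun _ _ _ h => ⟨h.1.symm, h.2⟩)
    (fun _ _ h => h.1 rfl) (fun _ _ h => Bool.noConfusion h.2.2) (fun p => p.elim)
  obtain ⟨σ, -, -, hσc⟩ := Sorted.exists_aut hlim hN (P := Empty) (Q := Empty) (o := Empty.elim)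
    (o' := Empty.elim) (g := Empty.elim) (c := c') (g' := Empty.elim)
    (c' := fun k => bif k then d else c) ⟨fun i => i.elim, fun i => i.elim, hs.sortC⟩
    ⟨fun i => i.elim, fun i => i.elim, by rintro (_ | _) <;> assumption⟩ (fun i => i.elim)
    (fun i => i.elim) hc' hcd (fun i => i.elim) (fun i => i.elim)
  have hσ := sameAtomic_equiv σ
  refine ⟨fun i => σ (g ⟨i⟩), fun i => (hσ.sortG_iff _).1 (hs.sortG _), fun i j hij => ?_⟩
  have h := (hσ.relR_iff (g ⟨i⟩) (g ⟨j⟩) (c' false)).1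
    ((hR' _ _ _).2 ⟨fun e => hij (congrArg ULift.down e), rfl⟩)
  rwa [hσc] at h

/-- Every vertex starts an infinite `R(·, ·, c)`-clique. -/
theorem exists_infinite_clique {b : N} (hb : sortG b) :
    ∃ e : ℕ → N, e 0 = b ∧ ∀ i j, i ≠ j → relR (e i) (e j) c := by
  have hU := ogUniversal_of_model_TOG (N := N) hlim
  have hfin : #(({c} : Set N)) < κ :=
    (Cardinal.lt_aleph0_of_finite _).trans hN.aleph0_lt
  have hnat : #(ULift.{w} ℕ) < κ := by simpa using hN.aleph0_lt
  let F : ℕ × ℕ → (n : ℕ) × LOG.Formula (ULift.{w} ℕ ⊕ Fin n) × (Fin n → N) := fun p =>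
    ⟨1, formulaR (.inl ⟨p.1⟩) (.inl ⟨p.2⟩) (.inr 0), fun _ => c⟩
  have hF : ∀ p (x : ULift.{w} ℕ → N), (F p).2.1.Realize (Sum.elim x (F p).2.2) ↔
      relR (x ⟨p.1⟩) (x ⟨p.2⟩) c := fun p x => realize_formulaR
  obtain ⟨e, he⟩ := hN.saturated {c} hfin hnat (F '' {p | p.1 ≠ p.2})
    (by rintro _ ⟨p, -, rfl⟩ i; rfl) (fun s hs => by
      classical
      obtain ⟨t, ht, rfl⟩ := Finset.subset_set_image_iff.1 hs
      obtain ⟨m, hm⟩ : ∃ m, ∀ p ∈ t, p.1 < m ∧ p.2 < m :=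
        ⟨t.sup (fun p => p.1 + p.2) + 1, fun p hp => by
          have := Finset.le_sup (f := fun p : ℕ × ℕ => p.1 + p.2) hp
          omega⟩
      obtain ⟨e, -, he⟩ := exists_finite_clique hlim hN hcd hc hd m
      refine ⟨fun i => if h : i.down < m then e ⟨i.down, h⟩ else c, fun q hq => ?_⟩
      obtain ⟨p, hp, rfl⟩ := Finset.mem_image.1 hq
      rw [hF]
      simp only [hm p hp, dif_pos]
      exact he _ _ fun h => ht hp (congrArg Fin.val h))
  have he' : ∀ i j, i ≠ j → relR (e ⟨i⟩) (e ⟨j⟩) c := fun i j hij =>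
    (hF (i, j) e).1 (he _ ⟨(i, j), hij, rfl⟩)
  obtain ⟨σ, -, hσg, hσc⟩ := Sorted.exists_aut hlim hN (P := Empty) (Q := Unit)
    (o := Empty.elim) (o' := Empty.elim) (g := fun _ => e ⟨0⟩) (g' := fun _ => b)
    (c := fun k => bif k then d else c) (c' := fun k => bif k then d else c)
    ⟨fun i => i.elim, fun _ => (hU.relR_sorts _ _ _ (he' 0 1 zero_ne_one)).1,
      by rintro (_ | _) <;> assumption⟩
    ⟨fun i => i.elim, fun _ => hb, by rintro (_ | _) <;> assumption⟩ (fun i => i.elim)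
    (fun _ _ => iff_of_true rfl rfl) hcd hcd
    (fun _ _ _ => iff_of_false (hU.relR_irrefl _ _) (hU.relR_irrefl _ _)) (fun i => i.elim)
  refine ⟨fun i => σ (e ⟨i⟩), hσg (), fun i j hij => ?_⟩
  have h := ((sameAtomic_equiv σ).relR_iff _ _ _).1 (he' i j hij)
  rwa [show σ c = c from hσc false] at h

theorem mem_acl_empty_iff {e : N} : e ∈ acl LOG N ∅ ↔ sortC e := by
  have hU := ogUniversal_of_model_TOG (N := N) hlim
  constructor
  · rintro ⟨n, φ, x, hx, hφ, hfin⟩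
    cases n with
    | succ n => exact (hx 0).elim
    | zero =>
      have haut : ∀ σ : N ≃[LOG] N, φ.Realize (Fin.cons (σ e) x) := fun σ => by
        rw [← StrongHomClass.realize_formula σ] at hφ
        convert hφ using 1
        ext i
        obtain rfl : i = 0 := Fin.fin_one_eq_zero i
        rfl
      obtain ⟨hO, hG⟩ := infinite_sorts (N := N) hlim
      rcases hU.cover e with he | he | he
      · refine (hO (hfin.subset fun e' he' => ?_)).elim
        obtain ⟨σ, hσ, -, -⟩ := Sorted.exists_aut hlim hN (P := Unit) (Q := Empty)
          (o := fun _ => e) (o' := fun _ => e') (g := Empty.elim) (g' := Empty.elim)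
          (c := fun k => bif k then d else c) (c' := fun k => bif k then d else c)
          ⟨fun _ => he, fun i => i.elim, by rintro (_ | _) <;> assumption⟩
          ⟨fun _ => he', fun i => i.elim, by rintro (_ | _) <;> assumption⟩
          (fun _ _ => iff_of_true rfl rfl) (fun i => i.elim) hcd hcd (fun i => i.elim)
          (fun _ i => i.elim)
        exact hσ () ▸ haut σ
      · refine (hG (hfin.subset fun e' he' => ?_)).elim
        obtain ⟨σ, -, hσ, -⟩ := Sorted.exists_aut hlim hN (P := Empty) (Q := Unit)
          (o := Empty.elim) (o' := Empty.elim) (g := fun _ => e) (g' := fun _ => e')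
          (c := fun k => bif k then d else c) (c' := fun k => bif k then d else c)
          ⟨fun i => i.elim, fun _ => he, by rintro (_ | _) <;> assumption⟩
          ⟨fun i => i.elim, fun _ => he', by rintro (_ | _) <;> assumption⟩
          (fun i => i.elim) (fun _ _ => iff_of_true rfl rfl) hcd hcd
          (fun _ _ _ => iff_of_false (hU.relR_irrefl _ _) (hU.relR_irrefl _ _))
          (fun i => i.elim)
        exact hσ () ▸ haut σ
      · exact he
  · intro he
    refine ⟨0, formulaC 0, Fin.elim0, fun i => i.elim0, realize_formulaC.2 he,
      (toFinite {c, d}).subset fun x hx => ?_⟩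
    exact hU.eq_of_sortC x c d (realize_formulaC.1 hx) hc hd hcd

theorem not_dind_acl_empty {a b : N} (hb : sortG b) (hE : relE a b c) :
    ¬dind LOG N {a} (acl LOG N ∅) {b} := by
  have hU := ogUniversal_of_model_TOG (N := N) hlim
  have hacl := fun e => mem_acl_empty_iff hlim hN hcd hc hd (e := e)
  obtain ⟨e, he0, he⟩ := exists_infinite_clique hlim hN hcd hc hd hb
  have hinj : ∀ i j, e i = e j ↔ i = j := fun i j => ⟨fun h => by
    by_contra hij
    exact hU.relR_irrefl _ _ (h ▸ he i j hij), fun h => h ▸ rfl⟩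
  have heG : ∀ i, sortG (e i) := fun i => (hU.relR_sorts _ _ _ (he i (i + 1) (by simp))).1
  refine not_not.2 ⟨2, formulaE (.inl ⟨a, rfl⟩) (.inr 0) (.inr 1), ![b, c], ?_,
    realize_formulaE.2 hE, fun i => ![e i, c], 2, two_pos, by simp only [he0], ?_, ?_⟩
  · exact Fin.forall_fin_two.2 ⟨.inl rfl, .inr ((hacl c).2 hc)⟩
  · intro n s t hs ht m φ x hx
    have hR : ∀ s : Fin n → ℕ, StrictMono s → ∀ (i j : Fin n) (k : N),
        relR (e (s i)) (e (s j)) k ↔ i ≠ j ∧ k = c := fun s hs i j k => by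
      constructor
      · refine fun h => ⟨?_, ?_⟩
        · rintro rfl
          exact hU.relR_irrefl _ _ h
        · by_cases hij : i = j
          · exact (hU.relR_irrefl _ _ (hij ▸ h)).elim
          · exact hU.relR_inj _ _ _ _ h (he _ _ fun h' => hij (hs.injective h'))
      · rintro ⟨hij, rfl⟩
        exact he _ _ fun h' => hij (hs.injective h')
    have hsort : ∀ s : Fin n → ℕ, Sorted (Empty.elim : Empty → N) (fun i => e (s i))
        (Sum.elim x fun k => bif k then d else c) := fun s =>
      ⟨fun i => i.elim, fun i => heG _, by
        rintro (i | _ | _)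
        exacts [(hacl _).1 (hx i), hc, hd]⟩
    have h := (hsort s).sameAtomic hU hU (hsort t) (fun i => i.elim)
      (fun i j => by rw [hinj, hinj, hs.injective.eq_iff, ht.injective.eq_iff])
      (fun _ _ => Iff.rfl) (fun i j k => by rw [hR s hs, hR t ht]) (fun i => i.elim)
    have key := realize_iff_of_sameAtomic hlim h (u := .inr (.inr (.inr false)))
      (v := .inr (.inr (.inr true))) hcd hc hd
      (φ.relabel (Sum.elim (fun p => .inr (![.inl p.1, .inr (.inr false)] p.2))
        fun i => .inr (.inr (.inl i))))
    simp only [Formula.realize_relabel] at key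
    convert key using 2 <;>
    · ext (⟨i, j⟩ | i)
      · fin_cases j <;> rfl
      · rfl
  · rintro s hs ⟨x, hx⟩
    obtain ⟨i, j, hij, rfl⟩ := Finset.card_eq_two.1 hs
    exact hU.not_relE _ _ _ _ (he i j hij)
      (realize_formulaE.1 (hx i (by simp))) (realize_formulaE.1 (hx j (by simp)))

end Monster

section Indiscernible

variable {L : FirstOrder.Language.{u, v}} {S : Type w} [L.Structure S] {C : Set S}

theorem Indiscernible.comp {ι ι' : Type*} {b : ℕ → ι → S} (h : Indiscernible L S C b)
    (f : ι' → ι) : Indiscernible L S C fun i => b i ∘ f := by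
  intro n s t hs ht m φ x hx
  have := h n s t hs ht m (φ.relabel (Sum.map (Prod.map id f) id)) x hx
  simp only [Formula.realize_relabel, Sum.elim_comp_map, Function.comp_id] at this
  exact this

theorem Indiscernible.realize_iff {ι : Type*} {b : ℕ → ι → S} (h : Indiscernible L S C b) {n : ℕ}
    (φ : L.Formula (Fin n × ι)) {s t : Fin n → ℕ} (hs : StrictMono s) (ht : StrictMono t) :
    φ.Realize (fun p => b (s p.1) p.2) ↔ φ.Realize (fun p => b (t p.1) p.2) := by
  have := h n s t hs ht 0 (φ.relabel Sum.inl) Fin.elim0 fun i => i.elim0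
  simpa only [Formula.realize_relabel, Sum.elim_comp_inl] using this

theorem strictMono_cons_cons {i j : ℕ} (h : i < j) : StrictMono ![i, j] := by
  simp [h]

theorem strictMono_cons_cons_cons_cons {i j k l : ℕ} (h : i < j) (h' : j < k) (h'' : k < l) :
    StrictMono ![i, j, k, l] := by
  simp [h, h', h'']

end Indiscernible

/-- In an indiscernible sequence of vertices, one of the two colours does not occur. -/
theorem OGUniversal.forall_not_relR_or {S : Type*} [LOG.Structure S] (hU : OGUniversal S)
    {A : Set S} {d : ℕ → S} (hd : Indiscernible LOG S A fun i (_ : Unit) => d i) {c₀ c₁ : S}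
    (hne : c₀ ≠ c₁) (hc₀ : sortC c₀) (hc₁ : sortC c₁) :
    (∀ i j, ¬relR (d i) (d j) c₀) ∨ ∀ i j, ¬relR (d i) (d j) c₁ := by
  have hedge : ∀ i j k l, i < j → k < l → (∃ c, relR (d i) (d j) c) →
      ∃ c, relR (d k) (d l) c := by
    intro i j k l hij hkl ⟨c, hc⟩
    have := hd.realize_iff
      ((formulaR (.inl (0, ())) (.inl (1, ())) (.inr ()) : LOG.Formula (Fin 2 × Unit ⊕ Unit)).iExs
        Unit) (strictMono_cons_cons hij) (strictMono_cons_cons hkl)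
    simp only [Formula.realize_iExs, realize_formulaR] at this
    obtain ⟨c', hc'⟩ := this.1 ⟨fun _ => c, hc⟩
    exact ⟨_, hc'⟩
  have hmono : ∀ i j k l i' j' k' l', i < j → j < k → k < l → i' < j' → j' < k' → k' < l' →
      (∃ c, relR (d i) (d j) c ∧ relR (d k) (d l) c) →
      ∃ c, relR (d i') (d j') c ∧ relR (d k') (d l') c := by
    intro i j k l i' j' k' l' hij hjk hkl hij' hjk' hkl' ⟨c, hc⟩
    have := hd.realize_iff
      ((formulaR (.inl (0, ())) (.inl (1, ())) (.inr ()) ⊓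
        formulaR (.inl (2, ())) (.inl (3, ())) (.inr ()) :
          LOG.Formula (Fin 4 × Unit ⊕ Unit)).iExs Unit)
      (strictMono_cons_cons_cons_cons hij hjk hkl) (strictMono_cons_cons_cons_cons hij' hjk' hkl')
    simp only [Formula.realize_iExs, Formula.realize_inf, realize_formulaR] at this
    obtain ⟨c', hc'⟩ := this.1 ⟨fun _ => c, hc⟩
    exact ⟨_, hc'⟩
  have hlt : ∀ c, (∃ i j, relR (d i) (d j) c) → ∃ i j, i < j ∧ relR (d i) (d j) c := by
    rintro c ⟨i, j, h⟩
    rcases lt_trichotomy i j with hij | rfl | hij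
    · exact ⟨i, j, hij, h⟩
    · exact (hU.relR_irrefl _ _ h).elim
    · exact ⟨j, i, hij, hU.relR_symm _ _ _ h⟩
  by_contra! ⟨h₀, h₁⟩
  obtain ⟨i, j, hij, h₀⟩ := hlt _ h₀
  obtain ⟨k, l, hkl, h₁⟩ := hlt _ h₁
  have hcol : ∀ p q, p < q → relR (d p) (d q) c₀ ∨ relR (d p) (d q) c₁ := fun p q hpq => by
    obtain ⟨c, hc⟩ := hedge _ _ p q hij hpq ⟨_, h₀⟩
    rcases hU.eq_of_sortC c c₀ c₁ (hU.relR_sorts _ _ _ hc).2.2 hc₀ hc₁ hne with rfl | rfl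
    exacts [.inl hc, .inr hc]
  have hall : ∀ i j k l, i < j → j < k → k < l →
      ∃ c, relR (d i) (d j) c ∧ relR (d k) (d l) c := by
    intro i j k l hij hjk hkl
    have h01 := hcol 0 1 (by simp)
    have h23 := hcol 2 3 (by simp)
    have h45 := hcol 4 5 (by simp)
    have : (∃ c, relR (d 0) (d 1) c ∧ relR (d 2) (d 3) c) ∨
        (∃ c, relR (d 0) (d 1) c ∧ relR (d 4) (d 5) c) ∨
        ∃ c, relR (d 2) (d 3) c ∧ relR (d 4) (d 5) c := by
      grind
    rcases this with h | h | h <;>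
      exact hmono _ _ _ _ _ _ _ _ (by simp) (by simp) (by simp) hij hjk hkl h
  have hm : ∀ c i j, i < j → relR (d i) (d j) c → ∀ m, j < m → relR (d m) (d (m + 1)) c := by
    intro c i j hij h m hjm
    obtain ⟨c', h', h''⟩ := hall i j m (m + 1) hij hjm (by simp)
    rwa [hU.relR_inj _ _ _ _ h h']
  exact hne (hU.relR_inj _ _ _ _ (hm _ _ _ hij h₀ (j + l + 1) (by omega))
    (hm _ _ _ hkl h₁ (j + l + 1) (by omega)))

section Monster

variable {M : Type w} [LOG'.Structure M] [Countable M] (hlim : IsFraisseLimit KOG M)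
  {N : Type w} [LOG.Structure N] [(TOG M).Model N] {κ : Cardinal.{w}} (hN : IsMonster LOG N κ)
include hlim hN

theorem dind_empty {a b c₀ c₁ : N} (ha : sortO a) (hb : sortG b) (hne : c₀ ≠ c₁)
    (hc₀ : sortC c₀) (hc₁ : sortC c₁) (hE₀ : relE a b c₀) (hE₁ : ¬relE a b c₁) :
    dind LOG N {a} ∅ {b} := by
  have hU := ogUniversal_of_model_TOG (N := N) hlim
  rintro ⟨m, φ, bb, hbb, hφ, bs, k, -, hbs, hind, hincons⟩
  replace hbb : bb = fun _ => b := funext fun i => by simpa using hbb i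
  subst hbb
  obtain ⟨d, hd, hdG, hdind⟩ : ∃ d : ℕ → N, (∀ i j, bs i j = d i) ∧ (∀ i, sortG (d i)) ∧
      Indiscernible LOG N ∅ fun i (_ : Unit) => d i := by
    cases m with
    | zero =>
      exact ⟨fun _ => b, fun i j => j.elim0, fun _ => hb, fun _ _ _ _ _ _ _ _ _ => Iff.rfl⟩
    | succ m =>
      have hmono : ∀ i : ℕ, StrictMono fun _ : Fin 1 => i := fun i =>
        Subsingleton.strictMono _
      refine ⟨fun i => bs i 0, fun i j => ?_, fun i => ?_, hind.comp fun _ => 0⟩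
      · have := hind.realize_iff (Term.equal (Term.var (0, j)) (Term.var (0, 0)))
          (hmono 0) (hmono i)
        simp only [Formula.realize_equal, Term.realize_var, hbs] at this
        exact this.1 trivial
      · have := hind.realize_iff
          (Relations.formula (L := LOG) RelOG.G fun _ => Term.var (0, 0)) (hmono 0) (hmono i)
        simp only [Formula.realize_rel, relMap_G_iff, Term.realize_var, hbs] at this
        exact this.1 hb
  obtain ⟨c, c', hcc', hc, hc', hR⟩ : ∃ c c' : N, c ≠ c' ∧ sortC c ∧ sortC c' ∧
      ∀ i j, ¬relR (d i) (d j) c := by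
    rcases hU.forall_not_relR_or hdind hne hc₀ hc₁ with h | h
    exacts [⟨c₀, c₁, hne, hc₀, hc₁, h⟩, ⟨c₁, c₀, hne.symm, hc₁, hc₀, h⟩]
  obtain ⟨o, ho, hoE⟩ := exists_relE_of_forall_not_relR hlim hN hcc' hc hc'
    (D := d '' Iio k) ((finite_Iio k).image d) (by rintro _ ⟨i, -, rfl⟩; exact hdG i)
    (by rintro _ ⟨i, -, rfl⟩ _ ⟨j, -, rfl⟩; exact hR i j)
  refine hincons (Finset.range k) (Finset.card_range k) ⟨fun _ => o, fun i hi => ?_⟩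
  obtain ⟨hoc, hoc'⟩ := hoE (d i) ⟨i, Finset.mem_range.1 hi, rfl⟩
  have hs : Sorted (fun _ : Unit => a) (fun _ : Unit => b) (fun k => bif k then c₁ else c₀) :=
    ⟨fun _ => ha, fun _ => hb, by rintro (_ | _) <;> assumption⟩
  have hs' : Sorted (fun _ : Unit => o) (fun _ : Unit => d i) (fun k => bif k then c' else c) :=
    ⟨fun _ => ho, fun _ => hdG i, by rintro (_ | _) <;> assumption⟩
  have h := hs.sameAtomic hU hU hs' (fun _ _ => iff_of_true rfl rfl)
    (fun _ _ => iff_of_true rfl rfl)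
    (by rintro (_ | _) <;> simp [hne, hcc', hne.symm, hcc'.symm])
    (fun _ _ _ => iff_of_false (hU.relR_irrefl _ _) (hU.relR_irrefl _ _))
    (by rintro _ _ (_ | _)
        exacts [iff_of_true hE₀ hoc, iff_of_false hE₁ hoc'])
  have key := realize_iff_of_sameAtomic hlim h (u := .inr (.inr false)) (v := .inr (.inr true))
    hne hc₀ hc₁
    (φ.relabel (Sum.elim (fun _ => .inl ()) fun _ => .inr (.inl ())))
  simp only [Formula.realize_relabel] at key
  convert key.1 ?_ using 1
  · ext (j | j)
    exacts [rfl, hd i j]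
  · convert hφ using 1
    ext (⟨_, rfl⟩ | j) <;> rfl

end Monster

/-- In the theory `T_OG`, fix `a` of sort `O` and `b` of sort `G` such that
`E(a,b,0)` and `¬E(a,b,1)` (where `0, 1` are the two elements of sort `C`).  Then `a ⫝d_∅ b`
but not `a ⫝d_{acl(∅)} b`.  In particular, in `T_OG` dividing independence over a base `C`
does not imply dividing independence over `acl(C)`. -/
theorem TOG_dind_fails_over_acl_base
    (M' : Type w) [LOG'.Structure M'] [Countable M']
    (hlim : IsFraisseLimit KOG M')
    (N : Type w) [LOG.Structure N] [(TOG M').Model N]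
    (κ : Cardinal.{w}) (hN : IsMonster LOG N κ)
    (a b : N) (haO : sortO a) (hbG : sortG b)
    (hE : ∃ c₀ c₁ : N, c₀ ≠ c₁ ∧ sortC c₀ ∧ sortC c₁ ∧ relE a b c₀ ∧ ¬relE a b c₁) :
    dind LOG N {a} ∅ {b} ∧ ¬dind LOG N {a} (acl LOG N ∅) {b} ∧
      ¬(∀ A C B : Set N, dind LOG N A C B → dind LOG N A (acl LOG N C) B) := by
  obtain ⟨c₀, c₁, hne, hc₀, hc₁, hE₀, hE₁⟩ := hE
  have hdind := dind_empty hlim hN haO hbG hne hc₀ hc₁ hE₀ hE₁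
  have hndind := not_dind_acl_empty hlim hN hne hc₀ hc₁ hbG hE₀
  exact ⟨hdind, hndind, fun h => hndind (h _ _ _ hdind)⟩

end PaperDiv
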